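/- Let α_0, ..., α_k ≥ 0 and let U_0, ..., U_k be independent uniform random variables on [0,1] with order statistics U_(0) ≤ ... ≤ U_(k). Then (1/(k+1)!) · E[ ∏_{j=0}^{k-1} ( (U_(j)/U_(j+1))^{α_j} · 1/U_(j+1) ) · U_(k)^{α_k} ] = ∏_{j=0}^{k} 1/(α_j + 1). -/

import Mathlib

open MeasureTheory

open scoped ENNReal

/-- The density in `s ∈ (0, t)` of `t * U ^ (1 / (a + 1))`, up to the factor `a + 1`. -/
noncomputable def powerDensity (a s t : ℝ) : ℝ≥0∞ :=
  (Set.Ioo 0 t).indicator (fun x => ENNReal.ofReal ((x / t) ^ a * (1 / t))) s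

/-- The product of the power densities along the chain `v 0, …, v (n - 1), t`. -/
noncomputable def chainDensity {n : ℕ} (a : Fin n → ℝ) (t : ℝ) (v : Fin n → ℝ) : ℝ≥0∞ :=
  ∏ j : Fin n, powerDensity (a j) (v j) (Fin.snoc (α := fun _ => ℝ) v t j.succ)

theorem powerDensity_ne_zero_imp {a s t : ℝ} (h : powerDensity a s t ≠ 0) : s ∈ Set.Ioo 0 t :=
  Set.mem_of_indicator_ne_zero h

theorem powerDensity_lt_top (a s t : ℝ) : powerDensity a s t < ∞ := by
  unfold powerDensity Set.indicator
  split_ifs <;> simp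

theorem measurable_powerDensity (a : ℝ) : Measurable fun p : ℝ × ℝ => powerDensity a p.1 p.2 := by
  have hs : MeasurableSet {p : ℝ × ℝ | p.1 ∈ Set.Ioo 0 p.2} :=
    (measurableSet_lt measurable_const measurable_fst).inter
      (measurableSet_lt measurable_fst measurable_snd)
  have hf : Measurable fun p : ℝ × ℝ => ENNReal.ofReal ((p.1 / p.2) ^ a * (1 / p.2)) := by
    fun_prop
  exact hf.indicator hs

theorem lintegral_powerDensity {a t : ℝ} (ha : 0 ≤ a) (ht : 0 < t) :
    ∫⁻ s, powerDensity a s t = ENNReal.ofReal (1 / (a + 1)) := by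
  have hc : Continuous fun x : ℝ => (x / t) ^ a * (1 / t) :=
    ((continuous_id.div_const t).rpow_const fun _ => Or.inr ha).mul continuous_const
  have hnonneg : ∀ x ∈ Set.Ioc 0 t, 0 ≤ (x / t) ^ a * (1 / t) := fun x hx => by
    have := hx.1
    positivity
  unfold powerDensity
  rw [lintegral_indicator measurableSet_Ioo, restrict_Ioo_eq_restrict_Ioc,
    ← ofReal_integral_eq_lintegral_ofReal]
  · congr 1
    rw [← intervalIntegral.integral_of_le ht.le, intervalIntegral.integral_mul_const,
      intervalIntegral.integral_comp_div (fun x => x ^ a) ht.ne', zero_div, div_self ht.ne',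
      integral_rpow (Or.inl (by linarith)), Real.one_rpow, Real.zero_rpow (by linarith)]
    simp only [smul_eq_mul]
    field_simp
    ring
  · exact (hc.integrableOn_Icc).mono_set Set.Ioc_subset_Icc_self
  · exact (ae_restrict_iff' measurableSet_Ioc).2 (ae_of_all _ hnonneg)

theorem measurable_chainDensity {n : ℕ} (a : Fin n → ℝ) (t : ℝ) :
    Measurable (chainDensity a t) := by
  refine Finset.measurable_fun_prod _ fun j _ => ?_
  have hw : Measurable fun v : Fin n → ℝ => Fin.snoc (α := fun _ => ℝ) v t j.succ := by
    induction j.succ using Fin.lastCases with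
    | last => simp
    | cast i => simpa using measurable_pi_apply i
  exact (measurable_powerDensity (a j)).comp ((measurable_pi_apply j).prodMk hw)

theorem chainDensity_lt_top {n : ℕ} (a : Fin n → ℝ) (t : ℝ) (v : Fin n → ℝ) :
    chainDensity a t v < ∞ :=
  ENNReal.prod_lt_top fun _ _ => powerDensity_lt_top _ _ _

theorem chainDensity_snoc {n : ℕ} (a : Fin (n + 1) → ℝ) (t s : ℝ) (v : Fin n → ℝ) :
    chainDensity a t (Fin.snoc (α := fun _ => ℝ) v s) =
      chainDensity (fun j => a j.castSucc) s v * powerDensity (a (Fin.last n)) s t := by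
  simp only [chainDensity, Fin.prod_univ_castSucc, Fin.succ_castSucc, Fin.succ_last,
    Fin.snoc_castSucc, Fin.snoc_last]

theorem lintegral_chainDensity {n : ℕ} (a : Fin n → ℝ) (ha : ∀ j, 0 ≤ a j) {t : ℝ} (ht : 0 < t) :
    ∫⁻ v, chainDensity a t v = ∏ j, ENNReal.ofReal (1 / (a j + 1)) := by
  induction n generalizing t with
  | zero => simp [chainDensity, volume_pi]
  | succ n ih =>
    have hp := (volume_preserving_piFinSuccAbove (fun _ : Fin (n + 1) => ℝ) (Fin.last n)).symm
    rw [← hp.lintegral_comp (measurable_chainDensity a t), Measure.volume_eq_prod,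
      lintegral_prod (fun p => chainDensity a t _)
        ((measurable_chainDensity a t).comp (MeasurableEquiv.measurable _)).aemeasurable]
    have hsnoc (s : ℝ) (v : Fin n → ℝ) :
        (MeasurableEquiv.piFinSuccAbove (fun _ : Fin (n + 1) => ℝ) (Fin.last n)).symm (s, v) =
          Fin.snoc (α := fun _ => ℝ) v s := by
      rw [← Fin.insertNth_last']
      rfl
    have hinner (s : ℝ) :
        ∫⁻ v : Fin n → ℝ, chainDensity a t (Fin.snoc (α := fun _ => ℝ) v s) =
          (∏ j : Fin n, ENNReal.ofReal (1 / (a j.castSucc + 1))) *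
            powerDensity (a (Fin.last n)) s t := by
      simp only [chainDensity_snoc]
      rw [lintegral_mul_const _ (measurable_chainDensity _ s)]
      by_cases hs : powerDensity (a (Fin.last n)) s t = 0
      · simp [hs]
      · rw [ih _ (fun j => ha _) (powerDensity_ne_zero_imp hs).1]
    simp only [hsnoc, hinner]
    have hlast : Measurable fun s => powerDensity (a (Fin.last n)) s t :=
      (measurable_powerDensity _).comp measurable_prodMk_right
    rw [lintegral_const_mul _ hlast,
      lintegral_powerDensity (ha _) ht, Fin.prod_univ_castSucc]

theorem chainDensity_ne_zero_imp {n : ℕ} {a : Fin n → ℝ} {t : ℝ} {v : Fin n → ℝ}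
    (h : chainDensity a t v ≠ 0) : StrictMono v ∧ ∀ i, v i ∈ Set.Ioo 0 t := by
  have hv : ∀ j : Fin n, v j ∈ Set.Ioo 0 (Fin.snoc (α := fun _ => ℝ) v t j.succ) := fun j =>
    powerDensity_ne_zero_imp (Finset.prod_ne_zero_iff.1 h j (Finset.mem_univ j))
  have hw : StrictMono (Fin.snoc (α := fun _ => ℝ) v t) :=
    Fin.strictMono_iff_lt_succ.2 fun j => by simpa using (hv j).2
  refine ⟨fun i j hij => ?_, fun i => ⟨(hv i).1, ?_⟩⟩
  · simpa using hw (Fin.castSucc_lt_castSucc_iff.2 hij)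
  · simpa using hw (Fin.castSucc_lt_last i)

theorem chainDensity_eq_ofReal {n : ℕ} {a : Fin (n + 1) → ℝ} {v : Fin (n + 1) → ℝ}
    (hmono : StrictMono v) (hv : ∀ i, v i ∈ Set.Ioo 0 1) :
    chainDensity a 1 v = ENNReal.ofReal
      ((∏ j : Fin n, ((v j.castSucc / v j.succ) ^ a j.castSucc * (1 / v j.succ))) *
        v (Fin.last n) ^ a (Fin.last n)) := by
  have hpos (i) : 0 < v i := (hv i).1
  rw [ENNReal.ofReal_mul (Finset.prod_nonneg fun j _ => by
      have := hpos j.castSucc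
      have := hpos j.succ
      positivity),
    ENNReal.ofReal_prod_of_nonneg fun j _ => by
      have := hpos j.castSucc
      have := hpos j.succ
      positivity]
  simp only [chainDensity, Fin.prod_univ_castSucc, Fin.succ_castSucc, Fin.succ_last,
    Fin.snoc_castSucc, Fin.snoc_last]
  congr 1
  · refine Finset.prod_congr rfl fun j _ => ?_
    have hmem : v j.castSucc ∈ Set.Ioo 0 (v j.succ) := ⟨hpos _, hmono j.castSucc_lt_succ⟩
    exact Set.indicator_of_mem hmem _
  · rw [powerDensity, Set.indicator_of_mem (hv _)]
    simp

theorem ae_injective_pi_real (ι : Type*) [Fintype ι] :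
    ∀ᵐ u : ι → ℝ, Function.Injective u := by
  classical
  have h (i j : ι) (hij : i ≠ j) : ∀ᵐ u : ι → ℝ, u i ≠ u j := by
    let L : (ι → ℝ) →ₗ[ℝ] ℝ :=
      (LinearMap.proj i : (ι → ℝ) →ₗ[ℝ] ℝ) - (LinearMap.proj j : (ι → ℝ) →ₗ[ℝ] ℝ)
    have hL : LinearMap.ker L ≠ ⊤ := fun htop => by
      have : L (Pi.single i 1) = 0 := by
        rw [LinearMap.ker_eq_top.1 htop, LinearMap.zero_apply]
      simp [L, hij.symm] at this
    refine measure_mono_null (fun u hu => ?_)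
      (Measure.addHaar_submodule (volume : Measure (ι → ℝ)) (LinearMap.ker L) hL)
    simpa [L, sub_eq_zero] using hu
  have h' : ∀ᵐ u : ι → ℝ, ∀ i j, i ≠ j → u i ≠ u j := by
    simp only [ae_all_iff]
    exact h
  filter_upwards [h'] with u hu i j huij
  by_contra hij
  exact hu i j hij huij

theorem Tuple.eq_sort_of_strictMono_comp {n : ℕ} {u : Fin n → ℝ} {σ : Equiv.Perm (Fin n)}
    (h : StrictMono (u ∘ σ)) : σ = Tuple.sort u :=
  Tuple.eq_sort_iff.2 ⟨h.monotone, fun _ _ hij heq => absurd heq (h hij).ne⟩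

theorem lintegral_comp_perm {ι : Type*} [Fintype ι] (σ : Equiv.Perm ι) {f : (ι → ℝ) → ℝ≥0∞}
    (hf : Measurable f) : ∫⁻ u, f (u ∘ σ) = ∫⁻ u, f u :=
  (volume_measurePreserving_piCongrLeft (fun _ : ι => ℝ) σ).symm.lintegral_comp hf

theorem sum_chainDensity_comp_perm {n : ℕ} (a : Fin n → ℝ) (t : ℝ) (u : Fin n → ℝ) :
    ∑ σ : Equiv.Perm (Fin n), chainDensity a t (u ∘ σ) =
      chainDensity a t (u ∘ Tuple.sort u) := by
  refine Finset.sum_eq_single _ (fun σ _ hσ => ?_) (by simp)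
  by_contra h
  exact hσ (Tuple.eq_sort_of_strictMono_comp (chainDensity_ne_zero_imp h).1)

theorem lintegral_chainDensity_sort {n : ℕ} (a : Fin n → ℝ) (ha : ∀ j, 0 ≤ a j) {t : ℝ}
    (ht : 0 < t) :
    ∫⁻ u, chainDensity a t (u ∘ Tuple.sort u) =
      n.factorial * ∏ j, ENNReal.ofReal (1 / (a j + 1)) := by
  simp_rw [← sum_chainDensity_comp_perm]
  rw [lintegral_finsetSum (f := fun (σ : Equiv.Perm (Fin n)) u => chainDensity a t (u ∘ σ)) _
    fun σ _ => (measurable_chainDensity a t).comp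
      (measurable_pi_lambda _ fun i => measurable_pi_apply (σ i))]
  simp_rw [lintegral_comp_perm _ (measurable_chainDensity a t), lintegral_chainDensity a ha ht]
  simp [Fintype.card_perm]

/-- Key expectation computation from the proof of Lemma 4.4: for order statistics
`U_(0) ≤ … ≤ U_(k)` of `k+1` i.i.d. uniforms on `[0,1]` and exponents `α_j ≥ 0`,
`(1/(k+1)!) E[∏_{j<k} (U_(j)/U_(j+1))^{α_j} / U_(j+1) · U_(k)^{α_k}] = ∏_j 1/(α_j+1)`. -/
theorem order_statistics_expectation (k : ℕ) (α : Fin (k + 1) → ℝ)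
    (hα : ∀ j, 0 ≤ α j) :
    (1 / ((k + 1).factorial : ℝ)) *
      ∫ u : Fin (k + 1) → ℝ,
        ((∏ j : Fin k,
            ((u (Tuple.sort u j.castSucc) / u (Tuple.sort u j.succ)) ^ α j.castSucc *
              (1 / u (Tuple.sort u j.succ)))) *
          u (Tuple.sort u (Fin.last k)) ^ α (Fin.last k))
        ∂(Measure.pi fun _ : Fin (k + 1) => volume.restrict (Set.Icc (0 : ℝ) 1))
      = ∏ j : Fin (k + 1), 1 / (α j + 1) := by
  have hμ : (Measure.pi fun _ : Fin (k + 1) => volume.restrict (Set.Icc (0 : ℝ) 1)) =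
      volume.restrict (Set.univ.pi fun _ => Set.Ioo (0 : ℝ) 1) := by
    simp_rw [← restrict_Ioo_eq_restrict_Icc]
    rw [← Measure.restrict_pi_pi, volume_pi]
  have hmeas : MeasurableSet (Set.univ.pi fun _ : Fin (k + 1) => Set.Ioo (0 : ℝ) 1) :=
    MeasurableSet.univ_pi fun _ => measurableSet_Ioo
  have hS : Measurable fun u : Fin (k + 1) → ℝ => chainDensity α 1 (u ∘ Tuple.sort u) := by
    simp_rw [← sum_chainDensity_comp_perm]
    exact Finset.measurable_fun_sum _ fun σ _ => (measurable_chainDensity α 1).comp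
      (measurable_pi_lambda _ fun i => measurable_pi_apply (σ i))
  have hprod : ∀ j, 0 ≤ 1 / (α j + 1) := fun j => by
    have := hα j
    positivity
  rw [hμ]
  calc
    _ = (1 / ((k + 1).factorial : ℝ)) *
        ∫ u in Set.univ.pi fun _ => Set.Ioo (0 : ℝ) 1,
          (chainDensity α 1 (u ∘ Tuple.sort u)).toReal := by
      congr 1
      refine integral_congr_ae ?_
      filter_upwards [ae_restrict_mem hmeas, ae_restrict_of_ae (ae_injective_pi_real _)]
        with u hu hinj
      have hu' (i) : (u ∘ Tuple.sort u) i ∈ Set.Ioo (0 : ℝ) 1 := hu _ (Set.mem_univ _)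
      rw [chainDensity_eq_ofReal ((Tuple.monotone_sort u).strictMono_of_injective
        (hinj.comp (Tuple.sort u).injective)) hu', ENNReal.toReal_ofReal]
      · rfl
      · refine mul_nonneg (Finset.prod_nonneg fun j _ => ?_) (Real.rpow_nonneg (hu' _).1.le _)
        exact mul_nonneg (Real.rpow_nonneg (div_nonneg (hu' _).1.le (hu' _).1.le) _)
          (one_div_nonneg.2 (hu' _).1.le)
    _ = (1 / ((k + 1).factorial : ℝ)) *
        (∫⁻ u, chainDensity α 1 (u ∘ Tuple.sort u)).toReal := by
      rw [integral_toReal hS.aemeasurable (ae_of_all _ fun u => chainDensity_lt_top _ _ _),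
        ← lintegral_indicator hmeas, Set.indicator_eq_self.2]
      intro u hu i _
      simpa using (chainDensity_ne_zero_imp hu).2 ((Tuple.sort u).symm i)
    _ = _ := by
      rw [lintegral_chainDensity_sort α hα one_pos,
        ← ENNReal.ofReal_prod_of_nonneg fun j _ => hprod j, ENNReal.toReal_mul,
        ENNReal.toReal_natCast, ENNReal.toReal_ofReal (Finset.prod_nonneg fun j _ => hprod j),
        one_div, inv_mul_cancel_left₀ (Nat.cast_ne_zero.2 (Nat.factorial_ne_zero _))]
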